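/- Under Assumption 1, the function J(θ) := ∑_{i∈S⁻} V^θ(i), where V^θ := (I − P_{π_θ})^{-1} R_{π_θ}, is differentiable in θ ∈ ℝ^{S⁻×A}, and for every state–action pair (s,u) its partial derivative with respect to the coordinate θ(s,u) equals (∑_{i∈S⁻} ((I − P_{π_θ})^{-1})_{i,s}) · π_θ(s,u) · k_{su}(V^θ). -/

import Mathlib

/-- The state-transition matrix `P_π` of a stationary randomized policy `π`. -/
noncomputable def Pmat {S A : Type*} [Fintype S] [Fintype A]
    (p : S → A → S → ℝ) (π : S → A → ℝ) : Matrix S S ℝ :=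
  Matrix.of fun i j => ∑ u, π i u * p i u j

/-- The expected one-stage cost vector `R_π` of a stationary randomized policy `π`. -/
noncomputable def Rvec {S A : Type*} [Fintype A]
    (g : S → A → ℝ) (π : S → A → ℝ) : S → ℝ :=
  fun i => ∑ u, π i u * g i u

/-- The softmax policy parameterized by `θ`. -/
noncomputable def softmax {S A : Type*} [Fintype A] (θ : S × A → ℝ) : S → A → ℝ :=
  fun i u => Real.exp (θ (i, u)) / ∑ u', Real.exp (θ (i, u'))

/-- The value function `V^θ = (I - P_{π_θ})⁻¹ R_{π_θ}` of the softmax policy `π_θ`. -/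
noncomputable def Vval {S A : Type*} [Fintype S] [Fintype A] [DecidableEq S]
    (p : S → A → S → ℝ) (g : S → A → ℝ) (θ : S × A → ℝ) : S → ℝ :=
  ((1 - Pmat p (softmax θ))⁻¹).mulVec (Rvec g (softmax θ))

/-- The temporal-difference term `k_{iu}(V) = ḡ(i,u) + ∑_j p(i,u,j) V(j) − V(i)`. -/
noncomputable def kTD {S A : Type*} [Fintype S]
    (p : S → A → S → ℝ) (g : S → A → ℝ) (V : S → ℝ) (i : S) (u : A) : ℝ :=
  g i u + ∑ j, p i u j * V j - V i

theorem aux_det_diff {E S : Type*} [NormedAddCommGroup E] [NormedSpace ℝ E] [Fintype S]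
    [DecidableEq S] (M : E → Matrix S S ℝ) (hM : ∀ i j, Differentiable ℝ fun x => M x i j) :
    Differentiable ℝ fun x => (M x).det := by
  simp only [Matrix.det_apply']
  refine Differentiable.fun_sum fun σ _ => ?_
  refine Differentiable.const_mul ?_ _
  exact fun x => (HasFDerivAt.finsetProd (u := Finset.univ) (g := fun i x => M x (σ i) i)
    fun i _ => (hM _ _ x).hasFDerivAt).differentiableAt

theorem aux_inv_diff {E S : Type*} [NormedAddCommGroup E] [NormedSpace ℝ E] [Fintype S]
    [DecidableEq S] (M : E → Matrix S S ℝ) (hM : ∀ i j, Differentiable ℝ fun x => M x i j)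
    (hd : ∀ x, (M x).det ≠ 0) (i j : S) :
    Differentiable ℝ fun x => (M x)⁻¹ i j := by
  simp only [Matrix.inv_def, Matrix.smul_apply, Ring.inverse_eq_inv', smul_eq_mul]
  refine Differentiable.mul (Differentiable.inv (aux_det_diff M hM) hd) ?_
  simp only [Matrix.adjugate_apply]
  refine aux_det_diff _ fun a b => ?_
  simp only [Matrix.updateRow_apply]
  by_cases h : a = j
  · simp [h]
  · simpa [h] using hM a b

theorem aux_Z_pos {S A : Type*} [Fintype A] [Nonempty A] (θ : S × A → ℝ) (i : S) :
    0 < ∑ u', Real.exp (θ (i, u')) :=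
  Finset.sum_pos (fun _ _ => Real.exp_pos _) Finset.univ_nonempty

theorem aux_softmax_nonneg {S A : Type*} [Fintype A] [Nonempty A] (θ : S × A → ℝ) (i : S) (u : A) :
    0 ≤ softmax θ i u := div_nonneg (Real.exp_pos _).le (aux_Z_pos θ i).le

theorem aux_softmax_sum {S A : Type*} [Fintype A] [Nonempty A] (θ : S × A → ℝ) (i : S) :
    ∑ u, softmax θ i u = 1 := by
  simp only [softmax, ← Finset.sum_div]
  exact div_self (aux_Z_pos θ i).ne'

theorem aux_softmax_diff {S A : Type*} [Fintype S] [Fintype A] [Nonempty A] (i : S) (u : A) :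
    Differentiable ℝ fun θ : S × A → ℝ => softmax θ i u := by
  unfold softmax
  simp only [div_eq_mul_inv]
  refine Differentiable.fun_mul (by fun_prop) (Differentiable.fun_inv ?_ fun θ => (aux_Z_pos θ i).ne')
  exact Differentiable.fun_sum fun v _ => by fun_prop

theorem aux_softmax_deriv {S A : Type*} [Fintype S] [Fintype A] [Nonempty A] (θ d : S × A → ℝ)
    (i : S) (u : A) :
    HasDerivAt (fun t : ℝ => softmax (θ + t • d) i u)
      (softmax θ i u * (d (i, u) - ∑ v, softmax θ i v * d (i, v))) 0 := by
  have he : ∀ v, HasDerivAt (fun t : ℝ => Real.exp ((θ + t • d) (i, v)))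
      (Real.exp (θ (i, v)) * d (i, v)) 0 := by
    intro v
    have h1 : HasDerivAt (fun t : ℝ => θ (i, v) + t * d (i, v)) (d (i, v)) 0 := by
      simpa using ((hasDerivAt_id (0 : ℝ)).mul_const (d (i, v))).const_add (θ (i, v))
    simpa using h1.exp
  have hZ := HasDerivAt.fun_sum (u := Finset.univ) fun v _ => he v
  have hz := (aux_Z_pos θ i).ne'
  have := (he u).fun_div hZ (by simpa using hz)
  simp only [zero_smul, add_zero] at this
  unfold softmax
  refine this.congr_deriv ?_
  symm
  have : ∑ v, Real.exp (θ (i, v)) / (∑ u', Real.exp (θ (i, u'))) * d (i, v)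
      = (∑ v, Real.exp (θ (i, v)) * d (i, v)) / (∑ u', Real.exp (θ (i, u'))) := by
    rw [Finset.sum_div]; exact Finset.sum_congr rfl fun v _ => by ring
  rw [this]
  field_simp

theorem aux_det_ne {S : Type*} [Fintype S] [DecidableEq S] (P : Matrix S S ℝ)
    (h : ∀ μ ∈ spectrum ℂ (P.map (algebraMap ℝ ℂ)), ‖μ‖ < 1) : (1 - P).det ≠ 0 := by
  intro h0
  have : (1 : ℂ) ∈ spectrum ℂ (P.map (algebraMap ℝ ℂ)) := by
    rw [spectrum.mem_iff, map_one, Matrix.isUnit_iff_isUnit_det, isUnit_iff_ne_zero, not_not]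
    have h1 : (1 - P.map (algebraMap ℝ ℂ)) = (algebraMap ℝ ℂ).mapMatrix (1 - P) := by
      rw [map_sub, map_one]; rfl
    rw [h1, ← RingHom.map_det, h0, map_zero]
  simpa using h 1 this

theorem aux_bellman {S A : Type*} [Fintype S] [Fintype A] [DecidableEq S]
    (p : S → A → S → ℝ) (g : S → A → ℝ) (θ : S × A → ℝ)
    (hd : (1 - Pmat p (softmax θ)).det ≠ 0) (i : S) :
    Vval p g θ i = ∑ u, softmax θ i u * (g i u + ∑ j, p i u j * Vval p g θ j) := by
  have h : (1 - Pmat p (softmax θ)).mulVec (Vval p g θ) = Rvec g (softmax θ) := by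
    unfold Vval
    rw [Matrix.mulVec_mulVec, Matrix.mul_nonsing_inv _ (isUnit_iff_ne_zero.2 hd),
      Matrix.one_mulVec]
  have h2 := congrFun h i
  rw [Matrix.sub_mulVec, Matrix.one_mulVec, Pi.sub_apply] at h2
  have h3 : (Pmat p (softmax θ)).mulVec (Vval p g θ) i
      = ∑ u, softmax θ i u * ∑ j, p i u j * Vval p g θ j := by
    simp only [Matrix.mulVec, dotProduct, Pmat, Matrix.of_apply, Finset.sum_mul, Finset.mul_sum]
    rw [Finset.sum_comm]
    exact Finset.sum_congr rfl fun _ _ => Finset.sum_congr rfl fun _ _ => by ring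
  rw [h3] at h2
  simp only [mul_add, Finset.sum_add_distrib]
  unfold Rvec at h2
  linarith

/-- Under Assumption 1, `J(θ) = ∑_i V^θ(i)` is differentiable in `θ`, and its
partial derivative in the coordinate `θ(s,u)` equals
`(∑_i ((I - P_{π_θ})⁻¹)_{i,s}) · π_θ(s,u) · k_{su}(V^θ)`. -/
theorem stmt_3 {S A : Type*} [Fintype S] [Fintype A] [Nonempty S] [Nonempty A]
    [DecidableEq S] [DecidableEq A]
    (p : S → A → S → ℝ)
    (hp : ∀ i u j, 0 ≤ p i u j) (hps : ∀ i u, ∑ j, p i u j ≤ 1)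
    (g : S → A → ℝ) (B : ℝ) (hB : 0 ≤ B) (hg : ∀ i u, |g i u| ≤ B)
    (hproper : ∀ π : S → A → ℝ, (∀ i u, 0 ≤ π i u) → (∀ i, ∑ u, π i u = 1) →
      ∀ μ ∈ spectrum ℂ ((Pmat p π).map (algebraMap ℝ ℂ)), ‖μ‖ < 1) :
    Differentiable ℝ (fun θ : S × A → ℝ => ∑ i, Vval p g θ i) ∧
    ∀ (θ : S × A → ℝ) (s : S) (u : A),
      fderiv ℝ (fun θ' : S × A → ℝ => ∑ i, Vval p g θ' i) θ (Pi.single (s, u) 1) =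
        (∑ i, (1 - Pmat p (softmax θ))⁻¹ i s) * softmax θ s u * kTD p g (Vval p g θ) s u := by
  have hdet : ∀ θ : S × A → ℝ, (1 - Pmat p (softmax θ)).det ≠ 0 := fun θ =>
    aux_det_ne _ (hproper _ (aux_softmax_nonneg θ) (aux_softmax_sum θ))
  have hV : ∀ i, Differentiable ℝ fun θ : S × A → ℝ => Vval p g θ i := by
    intro i
    simp only [Vval, Matrix.mulVec, dotProduct]
    refine Differentiable.fun_sum fun j _ => Differentiable.fun_mul ?_ ?_
    · refine aux_inv_diff _ (fun a b => ?_) hdet i j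
      simp only [Matrix.sub_apply, Pmat, Matrix.of_apply]
      exact (differentiable_const _).sub
        (Differentiable.fun_sum fun v _ => (aux_softmax_diff a v).mul_const _)
    · unfold Rvec
      exact Differentiable.fun_sum fun v _ => (aux_softmax_diff j v).mul_const _
  refine ⟨Differentiable.fun_sum fun i _ => hV i, fun θ s u => ?_⟩
  set d : S × A → ℝ := Pi.single (s, u) 1 with hd
  set W : S → ℝ := fun i => fderiv ℝ (fun θ' : S × A → ℝ => Vval p g θ' i) θ d with hW
  have hγ : HasDerivAt (fun t : ℝ => θ + t • d) d 0 := by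
    simpa using ((hasDerivAt_id (0 : ℝ)).smul_const d).const_add θ
  have hVd : ∀ i, HasDerivAt (fun t : ℝ => Vval p g (θ + t • d) i) (W i) 0 := by
    intro i
    have h1 : HasFDerivAt (fun θ' : S × A → ℝ => Vval p g θ' i)
        (fderiv ℝ (fun θ' : S × A → ℝ => Vval p g θ' i) θ) (θ + (0 : ℝ) • d) := by
      simpa using (hV i θ).hasFDerivAt
    exact h1.comp_hasDerivAt (0 : ℝ) hγ
  have hc : ∀ i, W i - ∑ j, Pmat p (softmax θ) i j * W j
      = ∑ v, softmax θ i v * d (i, v) * kTD p g (Vval p g θ) i v := by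
    intro i
    have h1 : HasDerivAt (fun t : ℝ => Vval p g (θ + t • d) i)
        (∑ v, (softmax θ i v * (d (i, v) - ∑ w, softmax θ i w * d (i, w)) *
          (g i v + ∑ j, p i v j * Vval p g θ j) + softmax θ i v * ∑ j, p i v j * W j)) 0 := by
      have h2 : (fun t : ℝ => Vval p g (θ + t • d) i) = fun t : ℝ =>
          ∑ v, softmax (θ + t • d) i v * (g i v + ∑ j, p i v j * Vval p g (θ + t • d) j) :=
        funext fun t => aux_bellman p g _ (hdet _) i
      rw [h2]
      refine HasDerivAt.fun_sum fun v _ => ?_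
      have h3 := (aux_softmax_deriv θ d i v).fun_mul
        ((HasDerivAt.fun_sum (u := Finset.univ) fun j _ =>
          (hVd j).const_mul (p i v j)).const_add (g i v))
      simpa only [zero_smul, add_zero] using h3
    have h4 := (hVd i).unique h1
    have h5 : ∑ j, Pmat p (softmax θ) i j * W j = ∑ v, softmax θ i v * ∑ j, p i v j * W j := by
      simp only [Pmat, Matrix.of_apply, Finset.sum_mul, Finset.mul_sum]
      rw [Finset.sum_comm]
      exact Finset.sum_congr rfl fun _ _ => Finset.sum_congr rfl fun _ _ => by ring
    rw [h4, h5, Finset.sum_add_distrib, add_sub_cancel_right]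
    have h6 := aux_bellman p g θ (hdet θ) i
    set D := ∑ w, softmax θ i w * d (i, w) with hD
    have h7 : ∑ v, softmax θ i v * (d (i, v) - D) * (g i v + ∑ j, p i v j * Vval p g θ j)
        = ∑ v, softmax θ i v * d (i, v) * (g i v + ∑ j, p i v j * Vval p g θ j)
          - D * Vval p g θ i := by
      rw [h6, Finset.mul_sum, ← Finset.sum_sub_distrib]
      exact Finset.sum_congr rfl fun _ _ => by ring
    rw [h7, hD, Finset.sum_mul, ← Finset.sum_sub_distrib]
    exact Finset.sum_congr rfl fun _ _ => by unfold kTD; ring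
  have hc2 : ∀ i, W i - ∑ j, Pmat p (softmax θ) i j * W j
      = if i = s then softmax θ s u * kTD p g (Vval p g θ) s u else 0 := by
    intro i
    rw [hc i]
    by_cases h : i = s
    · subst h
      simp only [hd, Pi.single_apply, Prod.mk.injEq, true_and, if_true]
      rw [Finset.sum_eq_single u]
      · simp
      · intro b _ hb; simp [hb]
      · simp
    · simp [hd, Pi.single_apply, h]
  have hmul : (1 - Pmat p (softmax θ)).mulVec W
      = fun i => if i = s then softmax θ s u * kTD p g (Vval p g θ) s u else 0 := by
    funext i
    rw [Matrix.sub_mulVec, Matrix.one_mulVec, Pi.sub_apply, ← hc2 i]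
    rfl
  have hWeq : W = ((1 - Pmat p (softmax θ))⁻¹).mulVec
      (fun i => if i = s then softmax θ s u * kTD p g (Vval p g θ) s u else 0) := by
    rw [← hmul, Matrix.mulVec_mulVec,
      Matrix.nonsing_inv_mul _ (isUnit_iff_ne_zero.2 (hdet θ)), Matrix.one_mulVec]
  rw [fderiv_fun_sum fun i _ => hV i θ, ContinuousLinearMap.sum_apply]
  change ∑ i, W i = _
  rw [hWeq, mul_assoc, Finset.sum_mul]
  refine Finset.sum_congr rfl fun i _ => ?_
  simp [Matrix.mulVec, dotProduct]
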